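/- Let 0 < a_1 ≤ a_2 ≤ ... ≤ a_n with a_1 < a_n (not all equal). Then the defect A_n(a) - G_n(a) = (1/π)∑_{ℓ=1}^{n-1} sin(ℓπ/n) ∫_{a_ℓ}^{a_{ℓ+1}} (∏_{k=1}^n |a_k - t|)^{1/n} dt/t is strictly positive. -/

import Mathlib

open Finset Real intervalIntegral

open Complex (I) in
/-- Cauchy's theorem on the upper half-annulus `ε ≤ ‖z‖ ≤ R`, for the form `h(z) dz / z`. -/
theorem upperHalfAnnulus_integral_eq_zero {h : ℂ → ℂ} (hc : ContinuousOn h {z | 0 ≤ z.im})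
    (hd : DifferentiableOn ℂ h {z | 0 < z.im}) {ε R : ℝ} (hε : 0 < ε) (hεR : ε ≤ R) :
    (∫ t in ε..R, h t / t) - (∫ t in ε..R, h (-t) / t)
      + I * (∫ θ in (0 : ℝ)..π, h (R * Complex.exp (θ * I)))
      - I * (∫ θ in (0 : ℝ)..π, h (ε * Complex.exp (θ * I))) = 0 := by
  have hR : 0 < R := hε.trans_le hεR
  have him (z : ℂ) (hz : z.im ∈ Set.Icc 0 π) : 0 ≤ (Complex.exp z).im := by
    rw [Complex.exp_im]
    exact mul_nonneg (Real.exp_pos _).le (sin_nonneg_of_mem_Icc hz)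
  have him' (z : ℂ) (hz : z.im ∈ Set.Ioo 0 π) : 0 < (Complex.exp z).im := by
    rw [Complex.exp_im]
    exact mul_pos (Real.exp_pos _) (sin_pos_of_mem_Ioo hz)
  have key := Complex.integral_boundary_rect_eq_zero_of_continuousOn_of_differentiableOn
    (fun w ↦ h (Complex.exp w)) (Real.log ε : ℂ) (Real.log R + π * I)
    (hc.comp Complex.continuous_exp.continuousOn fun z hz ↦ him z (by
      simpa [Set.uIcc_of_le pi_pos.le] using hz.2))
    (hd.comp Complex.differentiable_exp.differentiableOn fun z hz ↦ him' z (by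
      simpa [pi_pos.le] using hz.2))
  have hsubst (g : ℂ → ℂ) (hg : ContinuousOn (fun t : ℝ ↦ g t) (Set.Icc ε R)) :
      ∫ x in (Real.log ε)..(Real.log R), g (Real.exp x) = ∫ t in ε..R, g t / t := by
    have hle : Real.log ε ≤ Real.log R := Real.log_le_log hε hεR
    have himg : Real.exp '' Set.uIcc (Real.log ε) (Real.log R) ⊆ Set.Icc ε R := by
      rintro _ ⟨x, hx, rfl⟩
      rw [Set.uIcc_of_le hle] at hx
      exact ⟨(Real.log_le_iff_le_exp hε).1 hx.1, (Real.le_log_iff_exp_le hR).1 hx.2⟩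
    have hg' : ContinuousOn (fun t : ℝ ↦ g t / (t : ℂ)) (Set.Icc ε R) :=
      hg.div Complex.continuous_ofReal.continuousOn fun t ht ↦ by
        exact_mod_cast (hε.trans_le ht.1).ne'
    have := intervalIntegral.integral_deriv_smul_comp'' (f := Real.exp) (f' := Real.exp)
      (g := fun t : ℝ ↦ g t / (t : ℂ)) (a := Real.log ε) (b := Real.log R)
      Real.continuous_exp.continuousOn (fun x _ ↦ (Real.hasDerivAt_exp x).hasDerivWithinAt)
      Real.continuous_exp.continuousOn (hg'.mono himg)
    rw [Real.exp_log hε, Real.exp_log hR] at this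
    rw [← this]
    refine intervalIntegral.integral_congr fun x _ ↦ ?_
    simp [mul_div_cancel₀]
  have hcR (s : ℝ) : ContinuousOn (fun t : ℝ ↦ h ((s : ℂ) * t)) (Set.Icc ε R) :=
    hc.comp (by fun_prop) fun t _ ↦ by simp
  have h1 := hsubst h (by simpa using hcR 1)
  have h2 := hsubst (fun z ↦ h (-z)) (by simpa using hcR (-1))
  rw [← h1, ← h2]
  have hexp (r : ℝ) (hr : 0 < r) (y : ℝ) :
      Complex.exp ((Real.log r : ℂ) + y * I) = r * Complex.exp (y * I) := by
    rw [Complex.exp_add, ← Complex.ofReal_exp, Real.exp_log hr]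
  simpa [hexp _ hR, hexp _ hε, Complex.exp_add, ← Complex.ofReal_exp, Real.exp_log hε,
    Real.exp_log hR] using key

open Filter Topology in
theorem tendsto_integral_of_eventually_continuousAt {q : ℂ → ℂ}
    (hq : ∀ᶠ z in 𝓝 0, ContinuousAt q z) {u : ℝ → ℂ} (hu : Continuous u) (hu1 : ∀ θ, ‖u θ‖ = 1)
    (a b : ℝ) :
    Tendsto (fun r : ℝ ↦ ∫ θ in a..b, q (r * u θ)) (𝓝 0) (𝓝 ((b - a) * q 0)) := by
  obtain ⟨δ, hδ, hball⟩ := Metric.eventually_nhds_iff.1 hq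
  obtain ⟨δ', hδ', hbd⟩ := Metric.eventually_nhds_iff.1
    (hq.self_of_nhds.norm.eventually_lt_const (lt_add_one ‖q 0‖))
  have hnorm (r θ : ℝ) : dist (r * u θ) 0 = |r| := by simp [hu1]
  have hconst : ((b - a) * q 0) = ∫ _ in a..b, q 0 := by simp
  rw [hconst]
  refine intervalIntegral.tendsto_integral_filter_of_dominated_convergence (fun _ ↦ ‖q 0‖ + 1)
    ?_ ?_ (by simp) ?_
  · filter_upwards [Metric.ball_mem_nhds 0 hδ] with r hr
    refine Continuous.aestronglyMeasurable (continuous_iff_continuousAt.2 fun θ ↦ ?_)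
    exact ContinuousAt.comp (hball (by simpa [hnorm] using hr)) (by fun_prop)
  · filter_upwards [Metric.ball_mem_nhds 0 hδ'] with r hr
    exact .of_forall fun θ _ ↦ (hbd (by simpa [hu1] using hr)).le
  · refine .of_forall fun θ _ ↦ hq.self_of_nhds.tendsto.comp ?_
    have : Continuous fun r : ℝ ↦ (r : ℂ) * u θ := by fun_prop
    simpa using this.tendsto 0

theorem continuousOn_cpow_const_upperHalfPlane {c : ℂ} (hc : 0 < c.re) :
    ContinuousOn (fun z : ℂ ↦ z ^ c) {z | 0 ≤ z.im} := by
  intro z hz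
  by_cases h : 0 ≤ z.re ∨ z.im ≠ 0
  · exact (Complex.continuousAt_cpow_const_of_re_pos h hc).continuousWithinAt
  push Not at h
  have hz0 : z ≠ 0 := fun h0 ↦ by simp [h0] at h
  have hlog := Complex.continuousWithinAt_log_of_re_neg_of_im_zero h.1 h.2
  refine ((hlog.mul_const c).cexp).congr_of_eventuallyEq ?_ (Complex.cpow_def_of_ne_zero hz0 c)
  filter_upwards [mem_nhdsWithin_of_mem_nhds (isOpen_ne.mem_nhds hz0)] with w hw
  exact Complex.cpow_def_of_ne_zero hw c

theorem ofReal_add_cpow_eq_mul {a : ℝ} (ha : 0 ≤ a) {z : ℂ} (hz : 0 ≤ z.im) (haz : a < ‖z‖)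
    (c : ℂ) : ((a : ℂ) + z) ^ c = z ^ c * (1 + a * z⁻¹) ^ c := by
  have hz0 : z ≠ 0 := norm_pos_iff.1 (ha.trans_lt haz)
  have hnorm : ‖(a : ℂ) * z⁻¹‖ < 1 := by
    rw [norm_mul, norm_inv, Complex.norm_real, Real.norm_of_nonneg ha,
      ← div_eq_mul_inv, div_lt_one (ha.trans_lt haz)]
    exact haz
  have hre : 0 < (1 + a * z⁻¹).re := by
    have := (abs_lt.1 ((Complex.abs_re_le_norm _).trans_lt hnorm)).1
    rw [Complex.add_re, Complex.one_re]
    linarith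
  have him : (1 + a * z⁻¹).im ≤ 0 := by
    rw [Complex.add_im, Complex.one_im, Complex.im_ofReal_mul, Complex.inv_im, zero_add]
    exact mul_nonpos_of_nonneg_of_nonpos ha
      (div_nonpos_of_nonpos_of_nonneg (neg_nonpos.2 hz) (Complex.normSq_nonneg _))
  have hw0 : 1 + a * z⁻¹ ≠ 0 := fun h ↦ by simp [h] at hre
  have harg : (1 + a * z⁻¹).arg ≤ 0 := by
    rcases him.lt_or_eq with h | h
    · exact (Complex.arg_neg_iff.2 h).le
    · exact (Complex.arg_eq_zero_iff.2 ⟨hre.le, h⟩).le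
  have harg' := (abs_lt.1 (Complex.abs_arg_lt_pi_div_two_iff.2 (.inl hre))).1
  have hlog := Complex.log_mul hz0 hw0
    ⟨by linarith [Complex.arg_nonneg_iff.2 hz, pi_pos], by linarith [Complex.arg_le_pi z]⟩
  have hmul : (a : ℂ) + z = z * (1 + a * z⁻¹) := by field_simp; ring
  rw [hmul, Complex.cpow_def_of_ne_zero (mul_ne_zero hz0 hw0), hlog, add_mul, Complex.exp_add,
    ← Complex.cpow_def_of_ne_zero hz0, ← Complex.cpow_def_of_ne_zero hw0]

/-- The geometric mean of the translates `a k + z`, with principal `n`-th roots. -/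
noncomputable def translatedGeomMean (n : ℕ) (a : ℕ → ℝ) (z : ℂ) : ℂ :=
  ∏ k ∈ Finset.Icc 1 n, ((a k : ℂ) + z) ^ ((1 / n : ℝ) : ℂ)

/-- The branch at infinity of `translatedGeomMean`, in the coordinate `u = z⁻¹` and divided
by `z`. -/
noncomputable def geomMeanAtInfinity (n : ℕ) (a : ℕ → ℝ) (u : ℂ) : ℂ :=
  ∏ k ∈ Finset.Icc 1 n, (1 + (a k : ℂ) * u) ^ ((1 / n : ℝ) : ℂ)

section

variable {n : ℕ} {a : ℕ → ℝ}

theorem continuousOn_translatedGeomMean (hn : n ≠ 0) :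
    ContinuousOn (translatedGeomMean n a) {z | 0 ≤ z.im} := by
  have hc : 0 < (((1 / n : ℝ) : ℂ)).re := by
    rw [Complex.ofReal_re]; positivity
  exact continuousOn_finsetProd _ fun k _ ↦
    (continuousOn_cpow_const_upperHalfPlane hc).comp (by fun_prop) fun z hz ↦ by simpa using hz

theorem differentiableOn_translatedGeomMean :
    DifferentiableOn ℂ (translatedGeomMean n a) {z | 0 < z.im} := by
  refine DifferentiableOn.fun_finsetProd fun k _ z hz ↦ ?_
  refine DifferentiableAt.differentiableWithinAt (DifferentiableAt.cpow_const (by fun_prop) ?_)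
  exact .inr (by simpa using (ne_of_gt hz))

open Filter Topology in
theorem eventually_continuousAt_translatedGeomMean (ha : ∀ k ∈ Finset.Icc 1 n, 0 < a k) :
    ∀ᶠ z in 𝓝 0, ContinuousAt (translatedGeomMean n a) z := by
  have : ∀ᶠ z : ℂ in 𝓝 0, ∀ k ∈ Finset.Icc 1 n, (a k : ℂ) + z ∈ Complex.slitPlane := by
    refine (Filter.eventually_all_finset _).2 fun k hk ↦ ?_
    have hcont : ContinuousAt (fun z : ℂ ↦ (a k : ℂ) + z) 0 := by fun_prop
    exact hcont.eventually_mem (Complex.isOpen_slitPlane.mem_nhds (by simp [ha k hk]))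
  filter_upwards [this] with z hz
  refine tendsto_finsetProd _ fun k hk ↦ ?_
  exact ContinuousAt.comp (f := fun z : ℂ ↦ (a k : ℂ) + z)
    (continuousAt_cpow_const (hz k hk)) (by fun_prop)

theorem translatedGeomMean_zero (ha : ∀ k ∈ Finset.Icc 1 n, 0 < a k) :
    translatedGeomMean n a 0 = (((∏ k ∈ Finset.Icc 1 n, a k) ^ (1 / n : ℝ) : ℝ) : ℂ) := by
  rw [← Real.finsetProd_rpow _ _ fun k hk ↦ (ha k hk).le, Complex.ofReal_prod]
  refine Finset.prod_congr rfl fun k hk ↦ ?_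
  rw [add_zero, Complex.ofReal_cpow (ha k hk).le]

theorem translatedGeomMean_ofReal_im (ha : ∀ k ∈ Finset.Icc 1 n, 0 < a k) {t : ℝ} (ht : 0 ≤ t) :
    (translatedGeomMean n a t).im = 0 := by
  have : translatedGeomMean n a t
      = ((∏ k ∈ Finset.Icc 1 n, (a k + t) ^ (1 / n : ℝ) : ℝ) : ℂ) := by
    rw [Complex.ofReal_prod]
    refine Finset.prod_congr rfl fun k hk ↦ ?_
    rw [Complex.ofReal_cpow (add_nonneg (ha k hk).le ht), Complex.ofReal_add]
  rw [this, Complex.ofReal_im]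

theorem translatedGeomMean_neg_im {l : ℕ} (hl : l ≤ n) {t : ℝ}
    (h₁ : ∀ k ∈ Finset.Icc 1 l, a k ≤ t) (h₂ : ∀ k ∈ Finset.Icc (l + 1) n, t ≤ a k) :
    (translatedGeomMean n a (-t)).im
      = sin (l * π / n) * (∏ k ∈ Finset.Icc 1 n, |a k - t|) ^ (1 / n : ℝ) := by
  have hsplit (f : ℕ → ℂ) : ∏ k ∈ Finset.Icc 1 n, f k
      = (∏ k ∈ Finset.Icc 1 l, f k) * ∏ k ∈ Finset.Icc (l + 1) n, f k := by
    simp only [← Finset.Ico_add_one_right_eq_Icc]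
    exact (Finset.prod_Ico_consecutive f (by omega) (by omega)).symm
  have hprod : translatedGeomMean n a (-t)
      = (((∏ k ∈ Finset.Icc 1 n, |a k - t|) ^ (1 / n : ℝ) : ℝ) : ℂ)
        * Complex.exp (((l * π / n : ℝ) : ℂ) * Complex.I) := by
    rw [← Real.finsetProd_rpow _ _ fun k _ ↦ abs_nonneg _, Complex.ofReal_prod,
      translatedGeomMean, hsplit, hsplit]
    have e₁ : ∏ k ∈ Finset.Icc 1 l, ((a k : ℂ) + -t) ^ ((1 / n : ℝ) : ℂ)
        = (∏ k ∈ Finset.Icc 1 l, ((|a k - t| ^ (1 / n : ℝ) : ℝ) : ℂ))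
          * Complex.exp (((l * π / n : ℝ) : ℂ) * Complex.I) := by
      have : Complex.exp (((l * π / n : ℝ) : ℂ) * Complex.I)
          = ∏ _k ∈ Finset.Icc 1 l, Complex.exp (π * Complex.I * ((1 / n : ℝ) : ℂ)) := by
        rw [Finset.prod_const, Nat.card_Icc, Nat.add_sub_cancel, ← Complex.exp_nat_mul]
        congr 1
        push_cast
        ring
      rw [this, ← Finset.prod_mul_distrib]
      refine Finset.prod_congr rfl fun k hk ↦ ?_
      have hk' := sub_nonpos.2 (h₁ k hk)
      rw [← sub_eq_add_neg, ← Complex.ofReal_sub, Complex.ofReal_cpow_of_nonpos hk',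
        abs_of_nonpos hk', Complex.ofReal_cpow (neg_nonneg.2 hk'), Complex.ofReal_neg]
    have e₂ : ∏ k ∈ Finset.Icc (l + 1) n, ((a k : ℂ) + -t) ^ ((1 / n : ℝ) : ℂ)
        = ∏ k ∈ Finset.Icc (l + 1) n, ((|a k - t| ^ (1 / n : ℝ) : ℝ) : ℂ) := by
      refine Finset.prod_congr rfl fun k hk ↦ ?_
      have hk' := sub_nonneg.2 (h₂ k hk)
      rw [← sub_eq_add_neg, ← Complex.ofReal_sub, abs_of_nonneg hk', Complex.ofReal_cpow hk']
    rw [e₁, e₂]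
    ring
  rw [hprod, Complex.im_ofReal_mul, Complex.exp_ofReal_mul_I_im, mul_comm]

theorem translatedGeomMean_eq_mul_geomMeanAtInfinity (hn : n ≠ 0)
    (ha : ∀ k ∈ Finset.Icc 1 n, 0 < a k) {z : ℂ} (hz : 0 ≤ z.im)
    (haz : ∀ k ∈ Finset.Icc 1 n, a k < ‖z‖) :
    translatedGeomMean n a z = z * geomMeanAtInfinity n a z⁻¹ := by
  have hpow : ∏ _k ∈ Finset.Icc 1 n, z ^ ((1 / n : ℝ) : ℂ) = z := by
    rw [Finset.prod_const, Nat.card_Icc, Nat.add_sub_cancel]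
    simpa using Complex.cpow_nat_inv_pow z hn
  calc translatedGeomMean n a z
      = ∏ k ∈ Finset.Icc 1 n, z ^ ((1 / n : ℝ) : ℂ) * (1 + a k * z⁻¹) ^ ((1 / n : ℝ) : ℂ) :=
        Finset.prod_congr rfl fun k hk ↦ ofReal_add_cpow_eq_mul (ha k hk).le hz (haz k hk) _
    _ = z * geomMeanAtInfinity n a z⁻¹ := by
        rw [Finset.prod_mul_distrib, hpow, geomMeanAtInfinity]

theorem geomMeanAtInfinity_zero : geomMeanAtInfinity n a 0 = 1 := by
  simp [geomMeanAtInfinity]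

theorem hasDerivAt_geomMeanAtInfinity_zero :
    HasDerivAt (geomMeanAtInfinity n a) (((∑ k ∈ Finset.Icc 1 n, a k) / n : ℝ) : ℂ) 0 := by
  have h (k : ℕ) : HasDerivAt (fun u : ℂ ↦ (1 + (a k : ℂ) * u) ^ ((1 / n : ℝ) : ℂ))
      (((1 / n : ℝ) : ℂ) * a k) 0 := by
    have h₁ : HasDerivAt (fun u : ℂ ↦ 1 + (a k : ℂ) * u) (a k) 0 := by
      simpa using ((hasDerivAt_id (0 : ℂ)).const_mul (a k : ℂ)).const_add 1
    simpa using h₁.cpow_const (c := ((1 / n : ℝ) : ℂ)) (by simp)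
  refine (HasDerivAt.fun_finsetProd (u := Finset.Icc 1 n) fun k _ ↦ h k).congr_deriv ?_
  simp [← Finset.mul_sum, div_eq_inv_mul]

open Filter Topology in
theorem eventually_continuousAt_dslope_geomMeanAtInfinity :
    ∀ᶠ u in 𝓝 0, ContinuousAt (dslope (geomMeanAtInfinity n a) 0) u := by
  have : ∀ᶠ u : ℂ in 𝓝 0, ∀ k ∈ Finset.Icc 1 n, 1 + (a k : ℂ) * u ∈ Complex.slitPlane := by
    refine (Filter.eventually_all_finset _).2 fun k hk ↦ ?_
    have hcont : ContinuousAt (fun u : ℂ ↦ 1 + (a k : ℂ) * u) 0 := by fun_prop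
    exact hcont.eventually_mem (Complex.isOpen_slitPlane.mem_nhds (by simp))
  filter_upwards [this] with u hu
  rcases eq_or_ne u 0 with rfl | hu0
  · exact continuousAt_dslope_same.2 hasDerivAt_geomMeanAtInfinity_zero.differentiableAt
  refine (continuousAt_dslope_of_ne hu0).2 (tendsto_finsetProd _ fun k hk ↦ ?_)
  exact ContinuousAt.comp (f := fun u : ℂ ↦ 1 + (a k : ℂ) * u)
    (continuousAt_cpow_const (hu k hk)) (by fun_prop)

open Filter Topology in
theorem tendsto_re_integral_translatedGeomMean_inv (hn : n ≠ 0)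
    (ha : ∀ k ∈ Finset.Icc 1 n, 0 < a k) :
    Tendsto (fun r : ℝ ↦ (∫ θ in (0 : ℝ)..π,
        translatedGeomMean n a ((r⁻¹ : ℝ) * Complex.exp (θ * Complex.I))).re) (𝓝[>] 0)
      (𝓝 (π * ((∑ k ∈ Finset.Icc 1 n, a k) / n))) := by
  set q := dslope (geomMeanAtInfinity n a) 0 with hq
  have hlim := tendsto_integral_of_eventually_continuousAt
    (eventually_continuousAt_dslope_geomMeanAtInfinity (n := n) (a := a))
    (u := fun θ ↦ Complex.exp ((-θ : ℝ) * Complex.I)) (by fun_prop)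
    (fun θ ↦ Complex.norm_exp_ofReal_mul_I _) 0 π
  rw [dslope_same, hasDerivAt_geomMeanAtInfinity_zero.deriv] at hlim
  have hlim' := (Complex.continuous_re.tendsto _).comp (hlim.mono_left (nhdsWithin_le_nhds (s := Set.Ioi 0)))
  have hval : (((π : ℂ) - (0 : ℝ)) * (((∑ k ∈ Finset.Icc 1 n, a k) / n : ℝ) : ℂ)).re
      = π * ((∑ k ∈ Finset.Icc 1 n, a k) / n) := by
    rw [Complex.ofReal_zero, sub_zero, Complex.re_ofReal_mul, Complex.ofReal_re]
  rw [hval] at hlim'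
  refine hlim'.congr' ?_
  have hsmall : ∀ᶠ r : ℝ in 𝓝[>] 0, ∀ k ∈ Finset.Icc 1 n, a k < r⁻¹ :=
    (Filter.eventually_all_finset _).2 fun k _ ↦ tendsto_inv_nhdsGT_zero.eventually_gt_atTop _
  filter_upwards [hsmall, self_mem_nhdsWithin] with r hr hr0
  rw [Set.mem_Ioi] at hr0
  have him (θ : ℝ) (hθ : θ ∈ Set.Icc 0 π) :
      0 ≤ ((r⁻¹ : ℝ) * Complex.exp (θ * Complex.I)).im := by
    rw [Complex.im_ofReal_mul, Complex.exp_ofReal_mul_I_im]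
    exact mul_nonneg (inv_nonneg.2 hr0.le) (sin_nonneg_of_mem_Icc hθ)
  have hpt (θ : ℝ) (hθ : θ ∈ Set.Icc 0 π) :
      q (r * Complex.exp ((-θ : ℝ) * Complex.I))
        = translatedGeomMean n a ((r⁻¹ : ℝ) * Complex.exp (θ * Complex.I))
          - (r⁻¹ : ℝ) * Complex.exp (θ * Complex.I) := by
    have hinv : ((r⁻¹ : ℝ) * Complex.exp (θ * Complex.I))⁻¹
        = r * Complex.exp ((-θ : ℝ) * Complex.I) := by
      rw [mul_inv, ← Complex.exp_neg, Complex.ofReal_inv, inv_inv, Complex.ofReal_neg, neg_mul]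
    have hz0 : (r⁻¹ : ℝ) * Complex.exp (θ * Complex.I) ≠ 0 :=
      mul_ne_zero (Complex.ofReal_ne_zero.2 (inv_ne_zero hr0.ne')) (Complex.exp_ne_zero _)
    rw [translatedGeomMean_eq_mul_geomMeanAtInfinity hn ha (him θ hθ) (fun k hk ↦ by
      rw [norm_mul, Complex.norm_exp_ofReal_mul_I, mul_one, Complex.norm_real,
        Real.norm_of_nonneg (inv_nonneg.2 hr0.le)]
      exact hr k hk), ← hinv, hq, dslope_of_ne _ (inv_ne_zero hz0), slope_def_field,
      geomMeanAtInfinity_zero]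
    rw [sub_zero, div_inv_eq_mul]
    ring
  have hexp : ∫ θ in (0 : ℝ)..π, Complex.exp (θ * Complex.I) = 2 * Complex.I := by
    have := integral_exp_mul_complex (a := 0) (b := π) Complex.I_ne_zero
    simp only [mul_comm Complex.I] at this
    rw [this, Complex.exp_pi_mul_I, div_eq_iff Complex.I_ne_zero, mul_assoc, Complex.I_mul_I]
    norm_num
  have hint : IntervalIntegrable (fun θ : ℝ ↦
      translatedGeomMean n a ((r⁻¹ : ℝ) * Complex.exp (θ * Complex.I)))
      MeasureTheory.volume 0 π := by
    refine ContinuousOn.intervalIntegrable ?_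
    rw [Set.uIcc_of_le pi_pos.le]
    exact (continuousOn_translatedGeomMean hn).comp (by fun_prop) fun θ hθ ↦ him θ hθ
  have hcongr : ∫ θ in (0 : ℝ)..π, q (r * Complex.exp ((-θ : ℝ) * Complex.I))
      = (∫ θ in (0 : ℝ)..π, translatedGeomMean n a ((r⁻¹ : ℝ) * Complex.exp (θ * Complex.I)))
        - (r⁻¹ : ℝ) * (2 * Complex.I) := by
    rw [← hexp, ← intervalIntegral.integral_const_mul, ← intervalIntegral.integral_sub hint
      (Continuous.intervalIntegrable (by fun_prop) _ _)]
    refine intervalIntegral.integral_congr fun θ hθ ↦ hpt θ ?_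
    rwa [Set.uIcc_of_le pi_pos.le] at hθ
  simp only [Function.comp_apply]
  rw [hcongr, Complex.sub_re, Complex.re_ofReal_mul]
  simp

open Filter Topology in
theorem tendsto_re_integral_translatedGeomMean (ha : ∀ k ∈ Finset.Icc 1 n, 0 < a k) :
    Tendsto (fun r : ℝ ↦ (∫ θ in (0 : ℝ)..π,
        translatedGeomMean n a (r * Complex.exp (θ * Complex.I))).re) (𝓝[>] 0)
      (𝓝 (π * (∏ k ∈ Finset.Icc 1 n, a k) ^ (1 / n : ℝ))) := by
  have hlim := tendsto_integral_of_eventually_continuousAt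
    (eventually_continuousAt_translatedGeomMean ha)
    (u := fun θ ↦ Complex.exp (θ * Complex.I)) (by fun_prop)
    (fun θ ↦ Complex.norm_exp_ofReal_mul_I _) 0 π
  have hlim' := (Complex.continuous_re.tendsto _).comp (hlim.mono_left (nhdsWithin_le_nhds (s := Set.Ioi 0)))
  rw [translatedGeomMean_zero ha, Complex.ofReal_zero, sub_zero, Complex.re_ofReal_mul,
    Complex.ofReal_re] at hlim'
  exact hlim'

theorem integral_im_translatedGeomMean_neg (hn : n ≠ 0) (ha : ∀ k ∈ Finset.Icc 1 n, 0 < a k)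
    {ε R : ℝ} (hε : 0 < ε) (hεR : ε ≤ R) :
    ∫ t in ε..R, (translatedGeomMean n a (-t)).im / t
      = (∫ θ in (0 : ℝ)..π, translatedGeomMean n a (R * Complex.exp (θ * Complex.I))).re
        - (∫ θ in (0 : ℝ)..π, translatedGeomMean n a (ε * Complex.exp (θ * Complex.I))).re := by
  have hint (s : ℝ) : IntervalIntegrable
      (fun t : ℝ ↦ translatedGeomMean n a ((s : ℂ) * t) / (t : ℂ))
      MeasureTheory.volume ε R := by
    refine ContinuousOn.intervalIntegrable ?_
    rw [Set.uIcc_of_le hεR]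
    refine ContinuousOn.div ((continuousOn_translatedGeomMean hn).comp (by fun_prop)
      fun t _ ↦ by simp) Complex.continuous_ofReal.continuousOn fun t ht ↦ ?_
    exact_mod_cast (hε.trans_le ht.1).ne'
  have h₁ := Complex.imCLM.intervalIntegral_comp_comm (hint 1)
  have h₂ := Complex.imCLM.intervalIntegral_comp_comm (hint (-1))
  simp only [Complex.imCLM_apply, Complex.div_ofReal_im, Complex.ofReal_one, one_mul,
    Complex.ofReal_neg, neg_mul] at h₁ h₂
  have h₀ : ∫ t in ε..R, (translatedGeomMean n a t).im / t = 0 := by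
    rw [intervalIntegral.integral_congr (g := fun _ ↦ 0) fun t ht ↦ ?_]
    · simp
    · rw [Set.uIcc_of_le hεR] at ht
      simp [translatedGeomMean_ofReal_im ha (hε.le.trans ht.1)]
  have key := congrArg Complex.im (upperHalfAnnulus_integral_eq_zero
    (continuousOn_translatedGeomMean (a := a) hn) differentiableOn_translatedGeomMean hε hεR)
  rw [Complex.sub_im, Complex.add_im, Complex.sub_im, ← h₁, ← h₂, h₀, Complex.I_mul_im,
    Complex.I_mul_im, Complex.zero_im] at key
  linarith

theorem sum_integral_eq_integral_im_translatedGeomMean_neg (hn : 1 ≤ n)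
    (ha : ∀ k ∈ Finset.Icc 1 n, 0 < a k) (hmono : MonotoneOn a (Finset.Icc 1 n : Finset ℕ))
    {ε R : ℝ} (hε : 0 < ε) (hε₁ : ε ≤ a 1) (hR : a n ≤ R) :
    ∑ l ∈ Finset.Icc 1 (n - 1), sin (l * π / n) *
        ∫ t in (a l)..(a (l + 1)), (∏ k ∈ Finset.Icc 1 n, |a k - t|) ^ ((1 : ℝ) / n) / t
      = ∫ t in ε..R, (translatedGeomMean n a (-t)).im / t := by
  have hle {i j : ℕ} (hi : 1 ≤ i) (hij : i ≤ j) (hj : j ≤ n) : a i ≤ a j :=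
    hmono (by simp; omega) (by simp; omega) hij
  set f : ℝ → ℝ := fun t ↦ (translatedGeomMean n a (-t)).im / t with hf
  have hint {x y : ℝ} (hx : 0 < x) (hy : 0 < y) :
      IntervalIntegrable f MeasureTheory.volume x y := by
    refine ContinuousOn.intervalIntegrable (ContinuousOn.div ?_ continuousOn_id fun t ht ↦ ?_)
    · exact Complex.continuous_im.comp_continuousOn
        ((continuousOn_translatedGeomMean (by omega)).comp (by fun_prop) fun t _ ↦ by simp)
    · exact ((lt_min hx hy).trans_le ht.1).ne'
  have hpos (k : ℕ) (hk : 1 ≤ k) (hkn : k ≤ n) : 0 < a k := ha k (by simp; omega)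
  have hleft : ∫ t in ε..(a 1), f t = 0 := by
    rw [intervalIntegral.integral_congr (g := fun _ ↦ 0) fun t ht ↦ ?_]
    · simp
    · rw [Set.uIcc_of_le hε₁] at ht
      simp only [hf]
      rw [translatedGeomMean_neg_im (l := 0) (by omega) (by simp) fun k hk ↦ ?_]
      · simp
      · rw [Finset.mem_Icc] at hk
        exact ht.2.trans (hle le_rfl hk.1 hk.2)
  have hright : ∫ t in (a n)..R, f t = 0 := by
    rw [intervalIntegral.integral_congr (g := fun _ ↦ 0) fun t ht ↦ ?_]
    · simp
    · rw [Set.uIcc_of_le hR] at ht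
      simp only [hf]
      rw [translatedGeomMean_neg_im (l := n) le_rfl (fun k hk ↦ ?_) (by simp)]
      · rw [mul_div_cancel_left₀ _ (by positivity)]
        simp
      · rw [Finset.mem_Icc] at hk
        exact (hle hk.1 hk.2 le_rfl).trans ht.1
  have hmid : ∑ l ∈ Finset.Ico 1 n, ∫ t in (a l)..(a (l + 1)), f t = ∫ t in (a 1)..(a n), f t :=
    intervalIntegral.sum_integral_adjacent_intervals_Ico hn fun k hk ↦
      hint (hpos k hk.1 hk.2.le) (hpos _ (by omega) hk.2)
  have h₁ := hpos 1 le_rfl hn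
  have hₙ := hpos n hn le_rfl
  rw [← intervalIntegral.integral_add_adjacent_intervals (hint hε h₁)
    (hint h₁ (hₙ.trans_le hR)), ← intervalIntegral.integral_add_adjacent_intervals (hint h₁ hₙ)
    (hint hₙ (hₙ.trans_le hR)), hleft, hright, zero_add, add_zero, ← hmid]
  have hIcc : Finset.Icc 1 (n - 1) = Finset.Ico 1 n := by ext; simp; omega
  rw [hIcc]
  refine Finset.sum_congr rfl fun l hl ↦ ?_
  rw [Finset.mem_Ico] at hl
  rw [← intervalIntegral.integral_const_mul]
  refine intervalIntegral.integral_congr fun t ht ↦ ?_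
  rw [Set.uIcc_of_le (hle hl.1 (Nat.le_succ l) hl.2)] at ht
  simp only [hf]
  rw [translatedGeomMean_neg_im hl.2.le (fun k hk ↦ ?_) (fun k hk ↦ ?_)]
  · ring
  · rw [Finset.mem_Icc] at hk
    exact (hle hk.1 hk.2 hl.2.le).trans ht.1
  · rw [Finset.mem_Icc] at hk
    exact ht.2.trans (hle (by omega) hk.1 hk.2)

theorem geom_mean_lt_arith_mean_of_ne (ha : ∀ k ∈ Finset.Icc 1 n, 0 < a k) {i j : ℕ}
    (hi : i ∈ Finset.Icc 1 n) (hj : j ∈ Finset.Icc 1 n) (hij : a i ≠ a j) :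
    (∏ k ∈ Finset.Icc 1 n, a k) ^ ((1 : ℝ) / n) < (∑ k ∈ Finset.Icc 1 n, a k) / n := by
  have hn : 0 < n := by simp at hi; omega
  have h := (Real.geom_mean_lt_arith_mean_weighted_iff_of_pos (Finset.Icc 1 n)
    (fun _ ↦ (1 : ℝ) / n) a (fun _ _ ↦ by positivity) (by simp [hn.ne'])
    fun k hk ↦ (ha k hk).le).2 ⟨i, hi, j, hj, hij⟩
  rwa [Real.finsetProd_rpow _ _ fun k hk ↦ (ha k hk).le, ← Finset.mul_sum,
    one_div_mul_eq_div] at h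

end

theorem am_gm_defect_formula_and_positivity
    (n : ℕ) (hn : 2 ≤ n) (a : ℕ → ℝ)
    (hpos : ∀ k ∈ Finset.Icc 1 n, 0 < a k)
    (hmono : ∀ k ∈ Finset.Icc 1 (n - 1), a k ≤ a (k + 1))
    (hne : a 1 < a n) :
    (∑ k ∈ Finset.Icc 1 n, a k) / n - (∏ k ∈ Finset.Icc 1 n, a k) ^ ((1 : ℝ) / n)
        = (1 / Real.pi) *
          ∑ ℓ ∈ Finset.Icc 1 (n - 1),
            Real.sin (ℓ * Real.pi / n) *
              ∫ t in (a ℓ)..(a (ℓ + 1)),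
                (∏ k ∈ Finset.Icc 1 n, |a k - t|) ^ ((1 : ℝ) / n) / t
      ∧ 0 < (∑ k ∈ Finset.Icc 1 n, a k) / n
          - (∏ k ∈ Finset.Icc 1 n, a k) ^ ((1 : ℝ) / n) := by
  have hn1 : 1 ≤ n := by omega
  have hmono' : MonotoneOn a (Finset.Icc 1 n : Finset ℕ) := by
    rw [Finset.coe_Icc]
    refine monotoneOn_of_le_succ Set.ordConnected_Icc fun k _ hk hk' ↦ hmono k ?_
    simp only [Set.mem_Icc, Nat.succ_eq_succ] at hk hk'
    simp; omega
  refine ⟨?_, sub_pos.2 (geom_mean_lt_arith_mean_of_ne hpos (by simp; omega) (by simp; omega)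
    hne.ne)⟩
  have ha1 : 0 < a 1 := hpos 1 (by simp; omega)
  set S := ∑ ℓ ∈ Finset.Icc 1 (n - 1), Real.sin (ℓ * Real.pi / n) *
    ∫ t in (a ℓ)..(a (ℓ + 1)), (∏ k ∈ Finset.Icc 1 n, |a k - t|) ^ ((1 : ℝ) / n) / t with hS
  have hlim := (tendsto_re_integral_translatedGeomMean_inv (by omega) hpos).sub
    (tendsto_re_integral_translatedGeomMean hpos)
  have hconst := hlim.congr' (f₂ := fun _ ↦ S) (by
    filter_upwards [self_mem_nhdsWithin, mem_nhdsWithin_of_mem_nhds (Iio_mem_nhds ha1),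
      tendsto_inv_nhdsGT_zero.eventually_gt_atTop (a n)] with r hr hr1 hrn
    rw [Set.mem_Ioi] at hr
    rw [hS, sum_integral_eq_integral_im_translatedGeomMean_neg hn1 hpos hmono' hr
      (le_of_lt hr1) hrn.le]
    exact (integral_im_translatedGeomMean_neg (by omega) hpos hr
      ((le_of_lt hr1).trans (hne.le.trans hrn.le))).symm)
  have hSeq := tendsto_nhds_unique tendsto_const_nhds hconst
  rw [hSeq]
  field_simp
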